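/- There are no positive integers a, b with b odd and gcd(a,b) = 1 and no integer c such that −64a^8 − 16a^4b^2 + b^4 = c^2. -/

import Mathlib

/-- If a product of coprime positive integers is `2 ^ k * x ^ n` and the second factor is odd, then
the factors are `2 ^ k * r ^ n` and `s ^ n` for some factorization `x = r * s`. -/
lemma exists_eq_two_pow_mul_pow_of_mul_eq {k n : ℕ} (hn : n ≠ 0) {U V x : ℤ} (hU : 0 < U)
    (hV : 0 < V) (hx : 0 < x) (hUV : IsCoprime U V) (hodd : Odd V)
    (h : U * V = 2 ^ k * x ^ n) :
    ∃ r s : ℤ, 0 < r ∧ 0 < s ∧ IsCoprime r s ∧ r * s = x ∧ Odd s ∧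
      U = 2 ^ k * r ^ n ∧ V = s ^ n := by
  have h2V : IsCoprime ((2 : ℤ) ^ k) V := (Int.isCoprime_two_left.mpr hodd).pow_left
  obtain ⟨W, rfl⟩ : (2 : ℤ) ^ k ∣ U := h2V.dvd_of_dvd_mul_right ⟨x ^ n, h⟩
  have hW : 0 < W := pos_of_mul_pos_right hU (by positivity)
  have hWV : IsCoprime W V := hUV.of_mul_left_right
  have hprod : W * V = x ^ n :=
    mul_left_cancel₀ (pow_ne_zero k (two_ne_zero (α := ℤ))) (by rw [← h, mul_assoc])
  lift W to ℕ using hW.le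
  lift V to ℕ using hV.le
  lift x to ℕ using hx.le
  have hprod' : W * V = x ^ n := by exact_mod_cast hprod
  have hcop : IsUnit (gcd W V) := by
    rw [Nat.isUnit_iff]; exact Nat.isCoprime_iff_coprime.mp hWV
  have hcop' : IsUnit (gcd V W) := by rwa [gcd_comm]
  obtain ⟨r, rfl⟩ := exists_eq_pow_of_mul_eq_pow hcop hprod'
  obtain ⟨s, rfl⟩ := exists_eq_pow_of_mul_eq_pow hcop' ((mul_comm _ _).trans hprod')
  push_cast at hW hV hWV hodd
  have hr : r ≠ 0 := by rintro rfl; simp [hn] at hW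
  have hs : s ≠ 0 := by rintro rfl; simp [hn] at hV
  refine ⟨r, s, by positivity, by positivity,
    (IsCoprime.pow_iff (Nat.pos_of_ne_zero hn) (Nat.pos_of_ne_zero hn)).mp hWV, ?_,
    (Int.odd_pow' hn).mp hodd, by push_cast; rfl, by push_cast; rfl⟩
  rw [← mul_pow] at hprod'
  exact_mod_cast Nat.pow_left_injective hn hprod'

/-- Parametrization of `X ^ 2 - c ^ 2 = 4 * 2 ^ k * x ^ n` for `X` odd, positive and coprime
to `x`. -/
lemma exists_of_sq_sub_sq_eq {k n : ℕ} (hn : n ≠ 0) {X c x : ℤ} (hX : 0 < X)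
    (hodd : Odd X) (hx : 0 < x) (hXx : IsCoprime X x) (h : X ^ 2 - c ^ 2 = 4 * (2 ^ k * x ^ n)) :
    ∃ r s : ℤ, 0 < r ∧ 0 < s ∧ IsCoprime r s ∧ r * s = x ∧ Odd s ∧
      X = 2 ^ k * r ^ n + s ^ n ∧ (c = s ^ n - 2 ^ k * r ^ n ∨ c = 2 ^ k * r ^ n - s ^ n) := by
  have hpos : (0 : ℤ) < 2 ^ k * x ^ n := by positivity
  have hc : Odd c := by
    have : Odd (c ^ 2) := by
      rw [show c ^ 2 = X ^ 2 - 2 * (2 * (2 ^ k * x ^ n)) by linarith]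
      exact hodd.pow.sub_even (even_two_mul _)
    exact (Int.odd_pow' two_ne_zero).mp this
  obtain ⟨U, hU⟩ := hodd.sub_odd hc
  obtain ⟨V, rfl⟩ : ∃ V, X = U + V := ⟨X - U, by ring⟩
  obtain rfl : c = V - U := by linarith
  have hprod : U * V = 2 ^ k * x ^ n := by linarith
  have hUpos : 0 < U := by nlinarith
  have hVpos : 0 < V := by nlinarith
  have hUV : IsCoprime U V := by
    have h2 : IsCoprime (U + V) (2 : ℤ) := Int.isCoprime_two_right.mpr hodd
    have : IsCoprime (U + V) (U * V) := hprod ▸ h2.pow_right.mul_right hXx.pow_right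
    obtain ⟨p, q, hpq⟩ := this.of_mul_right_right
    exact ⟨p, p + q, by linear_combination hpq⟩
  rcases Int.even_or_odd V with hV | hV
  · have hUodd : Odd U := by simpa using hodd.sub_even hV
    obtain ⟨r, s, hr, hs, hrs, hx', hso, rfl, rfl⟩ :=
      exists_eq_two_pow_mul_pow_of_mul_eq hn hVpos hUpos hx hUV.symm hUodd
        ((mul_comm _ _).trans hprod)
    exact ⟨r, s, hr, hs, hrs, hx', hso, add_comm _ _, Or.inr rfl⟩
  · obtain ⟨r, s, hr, hs, hrs, hx', hso, rfl, rfl⟩ :=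
      exists_eq_two_pow_mul_pow_of_mul_eq hn hUpos hVpos hx hUV hV hprod
    exact ⟨r, s, hr, hs, hrs, hx', hso, rfl, Or.inl rfl⟩

/-- The fourth power of an odd integer is `1` modulo `8`. -/
lemma Int.exists_pow_four_eq_of_odd {s : ℤ} (hs : Odd s) : ∃ t, s ^ 4 = 8 * t + 1 := by
  obtain ⟨t, ht⟩ := Int.eight_dvd_sq_sub_one_of_odd hs
  exact ⟨t * (s ^ 2 + 1), by linear_combination (s ^ 2 + 1) * ht⟩

/-- The descent: a solution yields another one whose first entry is a proper divisor of `a`. -/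
lemma exists_smaller_solution {a b c : ℤ} (ha : 0 < a) (hb : 0 < b) (hodd : Odd b)
    (hab : IsCoprime a b) (h : -64 * a ^ 8 - 16 * a ^ 4 * b ^ 2 + b ^ 4 = c ^ 2) :
    ∃ a' b' c' : ℤ, 0 < a' ∧ a' < a ∧ 0 < b' ∧ Odd b' ∧ IsCoprime a' b' ∧
      -64 * a' ^ 8 - 16 * a' ^ 4 * b' ^ 2 + b' ^ 4 = c' ^ 2 := by
  have ha4 : 0 < a ^ 4 := by positivity
  have hX : 0 < b ^ 2 - 8 * a ^ 4 := by
    by_contra! hle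
    nlinarith [sq_nonneg c, mul_nonneg (sq_nonneg b) (sub_nonneg.mpr hle), sq_nonneg b]
  obtain ⟨r, s, hr, hs, -, rfl, hso, hXrs, -⟩ :=
    exists_of_sq_sub_sq_eq (k := 5) (n := 8) (c := c) (by norm_num) hX
      (hodd.pow.sub_even ⟨4 * a ^ 4, by ring⟩) ha
      (by
        have : IsCoprime (b ^ 2) a := hab.symm.pow_left
        rw [show b ^ 2 - 8 * a ^ 4 = b ^ 2 + a * (-8 * a ^ 3) by ring]
        exact this.add_mul_left_left _)
      (by linear_combination h)
  obtain ⟨v, u, hv, hu, hvu, rfl, huo, -, hc⟩ :=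
    exists_of_sq_sub_sq_eq (k := 2) (n := 8) (c := s ^ 4 + 4 * r ^ 4) (by norm_num) hb
      hodd hr hab.of_mul_left_left.symm (by linear_combination hXrs)
  obtain ⟨S, hS⟩ := Int.exists_pow_four_eq_of_odd hso
  obtain ⟨T, hT⟩ := Int.exists_pow_four_eq_of_odd huo
  replace hc : s ^ 4 + 4 * (v * u) ^ 4 = u ^ 8 - 4 * v ^ 8 := by
    rcases hc with hc | hc
    · linear_combination hc
    · have : u ^ 8 = (8 * T + 1) ^ 2 := by rw [← hT]; ring
      ring_nf at hc this
      omega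
  have hv4 : 0 < v ^ 4 := by positivity
  have hu4 : 0 < u ^ 4 := by positivity
  have hX : 0 < u ^ 4 - 2 * v ^ 4 := by
    by_contra! hle
    nlinarith [sq_nonneg (s ^ 2), mul_nonneg hu4.le (sub_nonneg.mpr hle)]
  obtain ⟨e, f, he, hf, -, rfl, hfo, hXef, -⟩ :=
    exists_of_sq_sub_sq_eq (k := 1) (n := 8) (c := s ^ 2) (by norm_num) hX
      (huo.pow.sub_even (even_two_mul _)) hv
      (by
        have : IsCoprime (u ^ 4) v := hvu.symm.pow_left
        rw [show u ^ 4 - 2 * v ^ 4 = u ^ 4 + v * (-2 * v ^ 3) by ring]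
        exact this.add_mul_left_left _)
      (by linear_combination -hc)
  obtain ⟨F, hF⟩ := Int.exists_pow_four_eq_of_odd hfo
  have hee : Even e := by
    by_contra! heo
    obtain ⟨E, hE⟩ := Int.exists_pow_four_eq_of_odd (Int.not_even_iff_odd.mp heo)
    have : u ^ 4 = ((8 * F + 1) + (8 * E + 1)) ^ 2 + (8 * E + 1) ^ 2 := by
      rw [← hF, ← hE]; linear_combination hXef
    ring_nf at this hT
    omega
  obtain ⟨d, rfl⟩ := even_iff_exists_two_mul.mp hee
  have hd : 0 < d := by linarith
  obtain ⟨w, g, hw, hg, hwg, rfl, hgo, -, hc'⟩ :=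
    exists_of_sq_sub_sq_eq (k := 6) (n := 8) (X := u ^ 2) (c := f ^ 4 + (2 * d) ^ 4)
      (by norm_num) (by positivity) huo.pow hd
      hvu.of_mul_left_left.of_mul_left_right.symm.pow_left (by linear_combination hXef)
  obtain ⟨G, hG⟩ := Int.exists_pow_four_eq_of_odd hgo
  replace hc' : f ^ 4 + (2 * (w * g)) ^ 4 = g ^ 8 - 64 * w ^ 8 := by
    rcases hc' with hc' | hc'
    · linear_combination hc'
    · have : g ^ 8 = (8 * G + 1) ^ 2 := by rw [← hG]; ring
      ring_nf at hc' this
      omega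
  refine ⟨w, g ^ 2, f ^ 2, hw, ?_, by positivity, hgo.pow, hwg.pow_right,
    by linear_combination -hc'⟩
  have hm : 0 < g * f * u * s := by positivity
  rw [show 2 * (w * g) * f * u * s = 2 * (w * (g * f * u * s)) by ring]
  nlinarith

/-- There are no positive integers `a, b` with `b` odd and `gcd (a, b) = 1`,
and no integer `c`, such that `−64a⁸ − 16a⁴b² + b⁴ = c²`. -/
theorem diophantine_eq4 :
    ¬ ∃ a b c : ℤ, 0 < a ∧ 0 < b ∧ Odd b ∧ IsCoprime a b ∧
      -64 * a ^ 8 - 16 * a ^ 4 * b ^ 2 + b ^ 4 = c ^ 2 := by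
  rintro ⟨a, b, c, ha, hb, hodd, hab, h⟩
  induction hN : a.toNat using Nat.strong_induction_on generalizing a b c with
  | _ N ih =>
    obtain ⟨a', b', c', ha', hlt, hb', hodd', hab', h'⟩ :=
      exists_smaller_solution ha hb hodd hab h
    exact ih a'.toNat (by omega) a' b' c' ha' hb' hodd' hab' h' rfl
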